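/- If n is an even positive integer with I(n) = 7/3 and n ∉ {12, 234}, then n has at least 5 distinct prime factors. -/

import Mathlib

open ArithmeticFunction in
/-- The abundancy index strictly increases along proper divisibility. -/
lemma sigma_one_mul_lt_of_dvd_of_ne {d n : ℕ} (hn : 0 < n) (hd : d ∣ n) (hne : d ≠ n) :
    sigma 1 d * n < sigma 1 n * d := by
  obtain ⟨e, rfl⟩ := hd
  have hd0 : 0 < d := Nat.pos_of_mul_pos_right hn
  have he : 1 < e := by
    have he0 : 0 < e := Nat.pos_of_mul_pos_left hn
    by_contra hcon
    obtain rfl : e = 1 := by omega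
    simp at hne
  suffices hs : e * sigma 1 d < sigma 1 (d * e) by nlinarith
  have hnot : 1 ∉ d.divisors.image (e * ·) := by
    intro hmem
    obtain ⟨x, -, hx⟩ := Finset.mem_image.mp hmem
    have := Nat.eq_one_of_mul_eq_one_right hx
    omega
  have hsub : insert 1 (d.divisors.image (e * ·)) ⊆ (d * e).divisors := by
    intro x hx
    rw [Nat.mem_divisors]
    refine ⟨?_, hn.ne'⟩
    rcases Finset.mem_insert.mp hx with rfl | hx
    · exact one_dvd _
    · obtain ⟨y, hy, rfl⟩ := Finset.mem_image.mp hx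
      rw [mul_comm d e]
      exact Nat.mul_dvd_mul_left e (Nat.dvd_of_mem_divisors hy)
  have hle := Finset.sum_le_sum_of_subset (f := fun x : ℕ => x) hsub
  rw [Finset.sum_insert hnot, Finset.sum_image (fun x _ y _ hxy => Nat.eq_of_mul_eq_mul_left
    (by omega) hxy), ← Finset.mul_sum] at hle
  simp only [sigma_one_apply]
  omega

open ArithmeticFunction in
lemma sub_one_mul_sigma_one_prime_pow {p : ℕ} (hp : p.Prime) (c : ℕ) :
    (p - 1) * sigma 1 (p ^ c) + 1 = p * p ^ c := by
  rw [sigma_one_apply_prime_pow hp, mul_comm, Nat.geomSum_eq hp.two_le,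
    Nat.div_mul_cancel (by simpa using Nat.sub_dvd_pow_sub_pow p 1 (c + 1)), pow_succ' p c]
  exact Nat.sub_add_cancel (Nat.mul_pos hp.pos (pow_pos hp.pos c))

lemma not_dvd_pow_sub_one_of_dvd_pow_add_one {a r h k : ℕ} (hr : 2 < r) (ha : 0 < a)
    (hh : r ∣ a ^ h + 1) (hk : Odd k) : ¬ r ∣ a ^ k - 1 := by
  intro hdvd
  have h1 : (a : ZMod r) ^ k = 1 := by
    have := (ZMod.natCast_eq_zero_iff _ _).mpr hdvd
    rw [Nat.cast_sub (Nat.one_le_pow _ _ ha)] at this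
    push_cast at this
    exact sub_eq_zero.mp this
  have h2 : (a : ZMod r) ^ h = -1 := by
    have := (ZMod.natCast_eq_zero_iff _ _).mpr hh
    push_cast at this
    exact eq_neg_of_add_eq_zero_left this
  have h3 : (-1 : ZMod r) = 1 := by
    rw [← hk.neg_one_pow, ← h2, ← pow_mul, mul_comm, pow_mul, h1, one_pow]
  have : Fact (2 < r) := ⟨hr⟩
  exact ZMod.neg_one_ne_one h3

/-- Below `784`, the only Wieferich prime to base `3` is `11`. -/
lemma three_pow_mod_sq_ne_one :
    ∀ q < 784, 28 < q → 3 ^ (q - 1) % q ^ 2 ≠ 1 := by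
  decide +kernel

/-- If `q` is not a Wieferich prime to base `3`, then `q ^ 2 ∣ 3 ^ k - 1` forces `q ∣ k`. -/
lemma dvd_of_sq_dvd_three_pow_sub_one {q k : ℕ} (hq : q.Prime) (hq3 : q ≠ 3)
    (hw : 3 ^ (q - 1) % q ^ 2 ≠ 1) (h : q ^ 2 ∣ 3 ^ k - 1) : q ∣ k := by
  have hk : (3 : ZMod (q ^ 2)) ^ k = 1 := by
    have := (ZMod.natCast_eq_zero_iff _ _).mpr h
    rw [Nat.cast_sub (Nat.one_le_pow _ _ (by norm_num))] at this
    push_cast at this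
    exact sub_eq_zero.mp this
  have hcop : Nat.Coprime 3 (q ^ 2) :=
    Nat.Coprime.pow_right _ ((Nat.coprime_primes Nat.prime_three hq).mpr hq3.symm)
  have htot : (3 : ZMod (q ^ 2)) ^ (q * (q - 1)) = 1 := by
    have := (ZMod.natCast_eq_natCast_iff _ _ _).mpr (Nat.ModEq.pow_totient hcop)
    rw [Nat.totient_prime_pow hq (by norm_num)] at this
    simpa using this
  by_contra hqk
  have hc : Nat.Coprime (orderOf (3 : ZMod (q ^ 2))) q :=
    Nat.Coprime.coprime_dvd_left (orderOf_dvd_of_pow_eq_one hk)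
      ((Nat.Prime.coprime_iff_not_dvd hq).mpr hqk).symm
  have hdvd := hc.dvd_of_dvd_mul_left (orderOf_dvd_of_pow_eq_one htot)
  have hone := orderOf_dvd_iff_pow_eq_one.mp hdvd
  apply hw
  have : ((3 ^ (q - 1) : ℕ) : ZMod (q ^ 2)) = (1 : ℕ) := by simpa using hone
  have := (ZMod.natCast_eq_natCast_iff _ _ _).mp this
  rw [Nat.ModEq, Nat.mod_eq_of_lt (Nat.one_lt_pow (by norm_num) hq.one_lt)] at this
  exact this

lemma three_pow_mod_four_of_odd {k : ℕ} (hk : Odd k) : 3 ^ k % 4 = 3 := by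
  obtain ⟨t, rfl⟩ := hk
  rw [pow_succ, pow_mul, Nat.mul_mod, Nat.pow_mod]
  norm_num

/-- For `k ≥ 7`, the repunit `(3 ^ k - 1) / 2` is not a power of a prime `28 < q < 784`. -/
lemma exists_prime_ne_dvd_of_three_pow {k s q : ℕ} (hk7 : 7 ≤ k)
    (hs : 2 * s + 1 = 3 ^ k) (hq : q.Prime) (hq28 : 28 < q) (hq784 : q < 784) :
    ∃ r, r.Prime ∧ r ∣ s ∧ r ≠ q := by
  by_contra! hall
  have hbig : 3 ^ 7 ≤ 3 ^ k := Nat.pow_le_pow_right (by norm_num) hk7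
  have h2s : 3 ^ k - 1 = 2 * s := by omega
  have hpow := Nat.eq_prime_pow_of_unique_prime_dvd (n := s) (p := q) (by omega)
    (fun {d} hd hds => hall d hd hds)
  have hj : 2 ≤ s.primeFactorsList.length := by
    by_contra hcon
    have := Nat.pow_le_pow_right hq.pos (show s.primeFactorsList.length ≤ 1 by omega)
    rw [← hpow, pow_one] at this
    omega
  have hsq : q ^ 2 ∣ 3 ^ k - 1 := by
    rw [h2s]
    exact (hpow ▸ pow_dvd_pow q hj : q ^ 2 ∣ s).mul_left 2
  have hqk := dvd_of_sq_dvd_three_pow_sub_one hq (by omega)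
    (three_pow_mod_sq_ne_one q hq784 hq28) hsq
  have hmod := three_pow_mod_four_of_odd (hq.odd_of_ne_two (by omega))
  obtain ⟨u, hu⟩ : ∃ u, 3 ^ q - 1 = 2 * u := ⟨(3 ^ q - 1) / 2, by omega⟩
  have hqbig : 3 ^ 7 ≤ 3 ^ q := Nat.pow_le_pow_right (by norm_num) (by omega)
  have hus : u ∣ s := by
    have := Nat.pow_sub_one_dvd_pow_sub_one 3 hqk
    rw [hu, h2s] at this
    exact Nat.dvd_of_mul_dvd_mul_left (by norm_num) this
  have hru := Nat.minFac_dvd u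
  have hr := Nat.minFac_prime (n := u) (by omega)
  rw [hall _ hr (hru.trans hus)] at hru
  have hdiv : q ∣ 3 ^ q - 1 := hu ▸ hru.mul_left 2
  have := Fact.mk hq
  have h0 := (ZMod.natCast_eq_zero_iff _ _).mpr hdiv
  rw [Nat.cast_sub (Nat.one_le_pow _ _ (by norm_num))] at h0
  push_cast at h0
  rw [ZMod.pow_card] at h0
  have h2 : ((2 : ℕ) : ZMod q) = 0 := by
    push_cast
    rw [← h0]
    norm_num
  have := Nat.le_of_dvd (by norm_num) ((ZMod.natCast_eq_zero_iff _ _).mp h2)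
  omega

/-- A prime other than `p` and `q` divides the repunit `(3 ^ k - 1) / 2`, for odd `k ≥ 7` and
`p`, `q` in the range relevant to abundancy index `7 / 3`. -/
lemma exists_prime_ne_ne_dvd_of_three_pow {k s p q : ℕ} (hk : Odd k) (hk7 : 7 ≤ k)
    (hs : 2 * s + 1 = 3 ^ k) (hp : p.Prime) (hq : q.Prime) (hp28 : 28 < p) (hpq : p < q)
    (hlt : 28 * ((p - 1) * (q - 1)) < 27 * (p * q)) :
    ∃ r, r.Prime ∧ r ∣ s ∧ r ≠ p ∧ r ≠ q := by
  obtain ⟨x, rfl⟩ : ∃ x, p = x + 29 := ⟨p - 29, by omega⟩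
  obtain ⟨y, rfl⟩ : ∃ y, q = x + 30 + y := ⟨q - (x + 30), by omega⟩
  rw [show x + 29 - 1 = x + 28 by omega, show x + 30 + y - 1 = x + 29 + y by omega] at hlt
  have hx : x < 27 := by nlinarith
  have hy : x + y < 754 := by nlinarith
  have h2s : 3 ^ k - 1 = 2 * s := by omega
  by_cases hps : x + 29 ∣ s
  · have hpk : x + 29 ∣ 3 ^ k - 1 := h2s ▸ hps.mul_left 2
    have hx18 : x = 18 := by
      have key : ∀ h, x + 29 ∣ 3 ^ h + 1 → False := fun h hh =>
        not_dvd_pow_sub_one_of_dvd_pow_add_one (by omega) (by norm_num) hh hk hpk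
      by_contra hne
      interval_cases x <;> first
        | omega
        | (refine absurd hp ?_; norm_num; done)
        | (refine key 14 ?_; norm_num; done)
        | (refine key 15 ?_; norm_num; done)
        | (refine key 9 ?_; norm_num; done)
        | (refine key 4 ?_; norm_num; done)
        | (refine key 21 ?_; norm_num; done)
        | (refine key 26 ?_; norm_num)
    subst hx18
    have hy21 : y < 21 := by omega
    have h23 : 23 ∣ k := by
      have h1 : (3 : ZMod 47) ^ k = 1 := by
        have := (ZMod.natCast_eq_zero_iff _ _).mpr hpk
        rw [Nat.cast_sub (Nat.one_le_pow _ _ (by norm_num))] at this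
        push_cast at this
        exact sub_eq_zero.mp this
      have : Fact (Nat.Prime 23) := ⟨by norm_num⟩
      rw [← orderOf_eq_prime (x := (3 : ZMod 47)) (p := 23) (by decide) (by decide)]
      exact orderOf_dvd_of_pow_eq_one h1
    have hbs : 1001523179 ∣ s := by
      have := Nat.pow_sub_one_dvd_pow_sub_one 3 h23
      rw [h2s] at this
      exact Nat.dvd_of_mul_dvd_mul_left (by norm_num)
        ((by norm_num : 2 * 1001523179 ∣ 3 ^ 23 - 1).trans this)
    have hr := Nat.minFac_prime (n := 1001523179) (by norm_num)
    have hrd := Nat.minFac_dvd 1001523179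
    refine ⟨_, hr, hrd.trans hbs, fun he => ?_, fun he => ?_⟩
    · rw [he] at hrd
      norm_num at hrd
    · rw [he] at hrd
      interval_cases y <;> revert hrd <;> norm_num
  · obtain ⟨r, hr, hrs, hrq⟩ := exists_prime_ne_dvd_of_three_pow hk7 hs hq (by omega) (by omega)
    exact ⟨r, hr, hrs, fun he => hps (he ▸ hrs), hrq⟩

open ArithmeticFunction in
/-- A number coprime to `6` whose prime factors exceed `28`, of abundancy index
`28 * 3 ^ b / (9 * (3 ^ (b + 1) - 1))` with `b ≥ 6` even, has at least three prime factors. -/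
lemma two_lt_card_primeFactors_of_sigma_eq {b m S : ℕ} (hb : Even b) (hb6 : 6 ≤ b) (hm : 0 < m)
    (hS : 2 * S + 1 = 3 ^ (b + 1)) (heq : 9 * S * sigma 1 m = 14 * 3 ^ b * m)
    (hprime : ∀ p, p.Prime → p ∣ m → 28 < p) : 2 < m.primeFactors.card := by
  have hX : 0 < 3 ^ b := pow_pos (by norm_num) b
  have hk : Odd (b + 1) := hb.add_one
  have hσ : 28 * m < 27 * sigma 1 m := by
    have hσ0 : 0 < sigma 1 m := sigma_pos 1 m hm.ne'
    rw [pow_succ] at hS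
    have : 3 ^ b * (28 * m) < 3 ^ b * (27 * sigma 1 m) := by nlinarith
    exact Nat.lt_of_mul_lt_mul_left this
  have hS_dvd : ∀ r, r.Prime → r ∣ S → r ∣ m := by
    intro r hr hrS
    have hr3k : r ∣ 3 ^ (b + 1) - 1 := by
      rw [show 3 ^ (b + 1) - 1 = 2 * S by omega]
      exact hrS.mul_left 2
    have h : r ∣ 14 * 3 ^ b * m := heq ▸ ((hrS.mul_left 9).mul_right _)
    rcases (hr.dvd_mul).mp h with h | h
    · exfalso
      rcases (hr.dvd_mul).mp h with h | h
      · rw [show 14 = 2 * 7 by norm_num, hr.dvd_mul, Nat.prime_dvd_prime_iff_eq hr (by norm_num),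
          Nat.prime_dvd_prime_iff_eq hr (by norm_num)] at h
        rcases h with rfl | rfl
        · have := three_pow_mod_four_of_odd hk
          omega
        · exact not_dvd_pow_sub_one_of_dvd_pow_add_one (h := 3) (by norm_num) (by norm_num)
            (by norm_num) hk hr3k
      · rw [(Nat.prime_dvd_prime_iff_eq hr Nat.prime_three).mp (hr.dvd_of_dvd_pow h)] at hrS
        rw [pow_succ] at hS
        omega
    · exact h
  by_contra hcard
  have hprod := Nat.prod_factorization_pow_eq_self hm.ne'
  rw [Nat.prod_factorization_eq_prod_primeFactors] at hprod
  obtain h0 | h1 | h2 : m.primeFactors.card = 0 ∨ m.primeFactors.card = 1 ∨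
    m.primeFactors.card = 2 := by omega
  · rw [Finset.card_eq_zero.mp h0, Finset.prod_empty] at hprod
    subst hprod
    simp at hσ
  · obtain ⟨p, hpm⟩ := Finset.card_eq_one.mp h1
    rw [hpm, Finset.prod_singleton] at hprod
    obtain ⟨hp, hpd⟩ := (Nat.mem_primeFactors.mp (hpm ▸ Finset.mem_singleton_self p :
      p ∈ m.primeFactors)).imp id And.left
    have h28 := hprime p hp hpd
    have h := sub_one_mul_sigma_one_prime_pow hp (m.factorization p)
    rw [hprod] at h
    obtain ⟨x, rfl⟩ : ∃ x, p = x + 29 := ⟨p - 29, by omega⟩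
    rw [show x + 29 - 1 = x + 28 by omega] at h
    nlinarith
  · obtain ⟨p, q, hpm, hpq⟩ : ∃ p q, m.primeFactors = {p, q} ∧ p < q := by
      obtain ⟨p, q, hne, hpm⟩ := Finset.card_eq_two.mp h2
      rcases hne.lt_or_gt with h | h
      · exact ⟨p, q, hpm, h⟩
      · exact ⟨q, p, by rw [hpm, Finset.pair_comm], h⟩
    rw [hpm, Finset.prod_pair hpq.ne] at hprod
    have hmem : ∀ r, r ∈ m.primeFactors ↔ r = p ∨ r = q := by simp [hpm]
    have hp := Nat.mem_primeFactors.mp ((hmem p).mpr (Or.inl rfl))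
    have hq := Nat.mem_primeFactors.mp ((hmem q).mpr (Or.inr rfl))
    have hp28 := hprime p hp.1 hp.2.1
    have hσp := sub_one_mul_sigma_one_prime_pow hp.1 (m.factorization p)
    have hσq := sub_one_mul_sigma_one_prime_pow hq.1 (m.factorization q)
    have hmul : sigma 1 m =
        sigma 1 (p ^ m.factorization p) * sigma 1 (q ^ m.factorization q) := by
      rw [← isMultiplicative_sigma.map_mul_of_coprime
        (Nat.coprime_pow_primes _ _ hp.1 hq.1 hpq.ne), hprod]
    have hlt : 28 * ((p - 1) * (q - 1)) < 27 * (p * q) := by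
      have hle : (p - 1) * (q - 1) * sigma 1 m ≤ p * q * m := by
        calc (p - 1) * (q - 1) * sigma 1 m
            = ((p - 1) * sigma 1 (p ^ m.factorization p)) *
              ((q - 1) * sigma 1 (q ^ m.factorization q)) := by rw [hmul]; ring
          _ ≤ (p * p ^ m.factorization p) * (q * q ^ m.factorization q) :=
              Nat.mul_le_mul (by omega) (by omega)
          _ = p * q * (p ^ m.factorization p * q ^ m.factorization q) := by ring
          _ = p * q * m := by rw [hprod]
      have hpos : 0 < (p - 1) * (q - 1) := Nat.mul_pos (by omega) (by omega)
      refine Nat.lt_of_mul_lt_mul_right (a := m) ?_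
      nlinarith
    obtain ⟨r, hr, hrS, hrp, hrq⟩ := exists_prime_ne_ne_dvd_of_three_pow hk (by omega) hS hp.1 hq.1
      hp28 hpq hlt
    rcases (hmem r).mp (Nat.mem_primeFactors.mpr ⟨hr, hS_dvd r hr hrS, hm.ne'⟩) with h | h
    · exact hrp h
    · exact hrq h

/-- If `n` is an even positive integer with abundancy index `7/3` and
`n ∉ {12, 234}`, then `n` has at least 5 distinct prime factors. -/
theorem even_friend_of_twelve_primeFactors (n : ℕ) (hn : 0 < n)
    (heven : Even n) (h : (ArithmeticFunction.sigma 1 n : ℚ) / n = 7 / 3)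
    (h12 : n ≠ 12) (h234 : n ≠ 234) :
    5 ≤ n.primeFactors.card := by
  have hσ : 3 * ArithmeticFunction.sigma 1 n = 7 * n := by
    have hn' : (n : ℚ) ≠ 0 := by exact_mod_cast hn.ne'
    rw [div_eq_div_iff hn' (by norm_num)] at h
    have : ArithmeticFunction.sigma 1 n * 3 = 7 * n := by exact_mod_cast h
    omega
  have habund : ∀ d, d ∣ n → d ≠ n → 3 * ArithmeticFunction.sigma 1 d < 7 * d := by
    intro d hd hne
    have := sigma_one_mul_lt_of_dvd_of_ne hn hd hne
    refine Nat.lt_of_mul_lt_mul_right (a := n) ?_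
    nlinarith
  have hn12 : ¬ 12 ∣ n := fun hd =>
    absurd (habund 12 hd h12.symm) (by decide)
  have hn234 : ¬ 234 ∣ n := fun hd =>
    absurd (habund 234 hd h234.symm) (by decide +kernel)
  have h3n : 3 ∣ n := by omega
  obtain ⟨u, rfl⟩ := heven.two_dvd
  have hu : 0 < u := by omega
  obtain ⟨b, m, hm3, rfl⟩ := Nat.exists_eq_pow_mul_and_not_dvd hu.ne' 3 (by norm_num)
  have hm : 0 < m := Nat.pos_of_mul_pos_left hu
  have hb0 : b ≠ 0 := by
    rintro rfl
    omega
  have hm2 : ¬ 2 ∣ m := by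
    intro h2
    obtain ⟨t, rfl⟩ := h2
    obtain ⟨c, rfl⟩ := Nat.exists_eq_succ_of_ne_zero hb0
    exact hn12 ⟨3 ^ c * t, by rw [Nat.succ_eq_add_one, pow_succ]; ring⟩
  have hc3 : Nat.Coprime (3 ^ b) m :=
    Nat.Coprime.pow_left b ((Nat.Prime.coprime_iff_not_dvd Nat.prime_three).mpr hm3)
  have hc2 : Nat.Coprime 2 (3 ^ b * m) :=
    Nat.Coprime.mul_right (Nat.Coprime.pow_right b (by norm_num))
      ((Nat.Prime.coprime_iff_not_dvd Nat.prime_two).mpr hm2)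
  have hsig2 : ArithmeticFunction.sigma 1 2 = 3 := by decide
  set S := ArithmeticFunction.sigma 1 (3 ^ b) with hSdef
  have hS : 2 * S + 1 = 3 ^ (b + 1) := by
    rw [pow_succ']
    exact sub_one_mul_sigma_one_prime_pow Nat.prime_three b
  have heq : 9 * S * ArithmeticFunction.sigma 1 m = 14 * 3 ^ b * m := by
    rw [ArithmeticFunction.isMultiplicative_sigma.map_mul_of_coprime hc2,
      ArithmeticFunction.isMultiplicative_sigma.map_mul_of_coprime hc3, hsig2] at hσ
    linarith
  have hb : Even b := by
    by_contra hodd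
    obtain ⟨t, rfl⟩ := Nat.not_even_iff_odd.mp hodd
    have hmod : 3 ^ (2 * t + 1 + 1) % 8 = 1 := by
      rw [show 2 * t + 1 + 1 = 2 * (t + 1) by ring, pow_mul, Nat.pow_mod]
      norm_num
    rw [← hS] at hmod
    have h4S : 4 ∣ S := by
      clear_value S
      clear hS
      omega
    have h4 : 4 ∣ 14 * 3 ^ (2 * t + 1) * m := by
      rw [← heq]
      exact (h4S.mul_left 9).mul_right _
    have h2 : 2 ∣ 3 ^ (2 * t + 1) * m := by
      rw [mul_assoc] at h4
      generalize 3 ^ (2 * t + 1) * m = Y at h4 ⊢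
      omega
    rw [Nat.Prime.dvd_mul Nat.prime_two] at h2
    rcases h2 with h2 | h2
    · exact absurd (Nat.prime_two.dvd_of_dvd_pow h2) (by norm_num)
    · exact hm2 h2
  have hb6 : 6 ≤ b := by
    by_contra hlt
    obtain rfl | rfl : b = 2 ∨ b = 4 := by
      obtain ⟨t, rfl⟩ := hb
      omega
    · rw [show S = 13 by omega] at heq
      have : 13 ∣ m := by omega
      exact hn234 (by omega)
    · rw [show S = 121 by omega] at heq
      have h11 : 11 ∣ m := by omega
      have hd : 1782 ∣ 2 * (3 ^ 4 * m) := by omega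
      have hval : ArithmeticFunction.sigma 1 1782 = 4356 := by decide +kernel
      by_cases hne : 1782 = 2 * (3 ^ 4 * m)
      · rw [← hne, hval] at hσ
        omega
      · have := habund 1782 hd hne
        omega
  have hprime : ∀ p, p.Prime → p ∣ m → 28 < p := by
    intro p hp hpm
    have hp2 : p ≠ 2 := by rintro rfl; exact hm2 hpm
    have hp3 : p ≠ 3 := by rintro rfl; exact hm3 hpm
    have hd : 1458 * p ∣ 2 * (3 ^ b * m) := by
      rw [show 1458 * p = 2 * (3 ^ 6 * p) by ring]
      exact Nat.mul_dvd_mul_left 2 (Nat.mul_dvd_mul (pow_dvd_pow 3 hb6) hpm)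
    have hcop : Nat.Coprime 1458 p := by
      rw [show 1458 = 2 * 3 ^ 6 by norm_num]
      exact Nat.Coprime.mul_left ((Nat.coprime_primes Nat.prime_two hp).mpr hp2.symm)
        (Nat.Coprime.pow_left 6 ((Nat.coprime_primes Nat.prime_three hp).mpr hp3.symm))
    have hval : ArithmeticFunction.sigma 1 (1458 * p) = 3279 * (p + 1) := by
      rw [ArithmeticFunction.isMultiplicative_sigma.map_mul_of_coprime hcop,
        show ArithmeticFunction.sigma 1 1458 = 3279 by decide +kernel]
      congr 1
      have := ArithmeticFunction.sigma_one_apply_prime_pow (i := 1) hp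
      rw [pow_one] at this
      rw [this]
      simp [Finset.sum_range_succ, add_comm]
    have hle : 3 * (3279 * (p + 1)) ≤ 7 * (1458 * p) := by
      rw [← hval]
      by_cases hne : 1458 * p = 2 * (3 ^ b * m)
      · rw [hne, hσ]
      · exact (habund _ hd hne).le
    have h27 : p ≠ 27 := by rintro rfl; norm_num at hp
    have h28 : p ≠ 28 := by rintro rfl; norm_num at hp
    omega
  have hcard := two_lt_card_primeFactors_of_sigma_eq hb hb6 hm hS heq hprime
  rw [hc2.primeFactors_mul, Finset.card_union_of_disjoint hc2.disjoint_primeFactors,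
    hc3.primeFactors_mul, Finset.card_union_of_disjoint hc3.disjoint_primeFactors,
    Nat.primeFactors_prime_pow hb0 Nat.prime_three, Nat.prime_two.primeFactors]
  simp only [Finset.card_singleton]
  omega
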